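/- arXiv:2501.09920 — 4 statements merged into one kernel-verified Lean document; each statement's English description precedes it below -/
import Mathlib

section
/- For every n ≥ 3, the secondary theta-seed Δ₂ := Σ_{σ} sgn(σ)·A_σ((θ_1 ξ_2 ρ_2 + θ_2 ξ_1 ρ_2 + θ_2 ξ_2 ρ_1)·θ_3 θ_4 ⋯ θ_{n−1}) is a weight vector of weight (n−2,1,1) annihilated by both raising operators: Δ₂ ∈ Λ_{n−2,1,1}, E^{θ←ξ}(Δ₂) = 0, and E^{ξ←ρ}(Δ₂) = 0, where E^{θ←ξ} := Σ_{i=1}^n (left multiplication by θ_i) ∘ ∂_{ξ_i} and E^{ξ←ρ} := Σ_{i=1}^n (left multiplication by ξ_i) ∘ ∂_{ρ_i}. -/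
noncomputable section

open ExteriorAlgebra

/-- The underlying vector space: `Fin 3 × Fin n → ℚ`, with standard basis `e (j,i)`. -/
abbrev V (n : ℕ) : Type := (Fin 3 × Fin n) → ℚ

/-- Standard basis vector `e_{(j,i)}`. -/
def e (n : ℕ) (j : Fin 3) (i : Fin n) : V n := Pi.single (j, i) 1

/-- The exterior algebra `Λ` on three sets of `n` anticommuting variables. -/
abbrev Lam (n : ℕ) : Type := ExteriorAlgebra ℚ (V n)

/-- The variable `θ_i`. -/
def θ (n : ℕ) (i : Fin n) : Lam n := ExteriorAlgebra.ι ℚ (e n 0 i)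

/-- The variable `ξ_i`. -/
def ξ (n : ℕ) (i : Fin n) : Lam n := ExteriorAlgebra.ι ℚ (e n 1 i)

/-- The variable `ρ_i`. -/
def ρ (n : ℕ) (i : Fin n) : Lam n := ExteriorAlgebra.ι ℚ (e n 2 i)

/-- The algebra automorphism `A_σ` of `Λ` induced functorially by the linear automorphism
of `V` sending `e_{(j,i)}` to `e_{(j,σ(i))}`. -/
def A (n : ℕ) (σ : Equiv.Perm (Fin n)) : Lam n →ₐ[ℚ] Lam n :=
  ExteriorAlgebra.map (LinearMap.funLeft ℚ ℚ (fun p => (p.1, σ⁻¹ p.2)))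

/-- `f ∈ Λ` is antisymmetric if `A_σ f = sgn(σ) • f` for every permutation `σ`. -/
def IsAntisymmetric (n : ℕ) (f : Lam n) : Prop :=
  ∀ σ : Equiv.Perm (Fin n), A n σ f = ((Equiv.Perm.sign σ : ℤ) : ℚ) • f

/-- The contraction operator `∂_{θ_i}` (left contraction with the dual basis
functional of `e_{(0,i)}`). -/
def dθ (n : ℕ) (i : Fin n) : Module.End ℚ (Lam n) :=
  CliffordAlgebra.contractLeft (LinearMap.proj ((0 : Fin 3), i))

/-- The contraction operator `∂_{ξ_i}` (left contraction with the dual basis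
functional of `e_{(1,i)}`). -/
def dξ (n : ℕ) (i : Fin n) : Module.End ℚ (Lam n) :=
  CliffordAlgebra.contractLeft (LinearMap.proj ((1 : Fin 3), i))

/-- The contraction operator `∂_{ρ_i}` (left contraction with the dual basis
functional of `e_{(2,i)}`). -/
def dρ (n : ℕ) (i : Fin n) : Module.End ℚ (Lam n) :=
  CliffordAlgebra.contractLeft (LinearMap.proj ((2 : Fin 3), i))

/-- The differential operator `Σ_{i=1}^n ∂_{θ_i}^h ∘ ∂_{ξ_i}^k ∘ ∂_{ρ_i}^ℓ`. -/
def D (n : ℕ) (h k l : ℕ) : Module.End ℚ (Lam n) :=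
  ∑ i : Fin n, (dθ n i) ^ h * (dξ n i) ^ k * (dρ n i) ^ l

/-- The trigraded component `Λ_{a,b,c}`: the ℚ-linear span of all products
`θ_{i_1}⋯θ_{i_a} · ξ_{j_1}⋯ξ_{j_b} · ρ_{k_1}⋯ρ_{k_c}` with strictly increasing indices. -/
def lamGrade (n : ℕ) (a b c : ℕ) : Submodule ℚ (Lam n) :=
  Submodule.span ℚ { x | ∃ (p : Fin a → Fin n) (q : Fin b → Fin n) (r : Fin c → Fin n),
    StrictMono p ∧ StrictMono q ∧ StrictMono r ∧
    x = (List.ofFn fun i => θ n (p i)).prod * (List.ofFn fun i => ξ n (q i)).prod *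
        (List.ofFn fun i => ρ n (r i)).prod }

/-- The secondary theta-seed
`Δ₂ = Σ_σ sgn(σ) • A_σ((θ_1 ξ_2 ρ_2 + θ_2 ξ_1 ρ_2 + θ_2 ξ_2 ρ_1) θ_3 θ_4 ⋯ θ_{n-1})`. -/
def Δ₂ (n : ℕ) (hn : 3 ≤ n) : Lam n :=
  ∑ σ : Equiv.Perm (Fin n), ((Equiv.Perm.sign σ : ℤ) : ℚ) •
    A n σ ((θ n ⟨0, by omega⟩ * ξ n ⟨1, by omega⟩ * ρ n ⟨1, by omega⟩ +
            θ n ⟨1, by omega⟩ * ξ n ⟨0, by omega⟩ * ρ n ⟨1, by omega⟩ +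
            θ n ⟨1, by omega⟩ * ξ n ⟨1, by omega⟩ * ρ n ⟨0, by omega⟩) *
           (List.ofFn fun i : Fin (n - 3) =>
             θ n ⟨(i : ℕ) + 2, by have := i.isLt; omega⟩).prod)

/-- The raising operator `E^{θ←ξ} = Σ_{i=1}^n (left multiplication by θ_i) ∘ ∂_{ξ_i}`. -/
def Eθξ (n : ℕ) : Module.End ℚ (Lam n) :=
  ∑ i : Fin n, (LinearMap.mulLeft ℚ (θ n i)) ∘ₗ (dξ n i)

/-- The raising operator `E^{ξ←ρ} = Σ_{i=1}^n (left multiplication by ξ_i) ∘ ∂_{ρ_i}`. -/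
def Eξρ (n : ℕ) : Module.End ℚ (Lam n) :=
  ∑ i : Fin n, (LinearMap.mulLeft ℚ (ξ n i)) ∘ₗ (dρ n i)

/-- The operator `∑ i, e_{(j,i)} ∘ ∂_{(k,i)}` replacing variables of type `k` by type `j`. -/
def polarization (n : ℕ) (j k : Fin 3) : Module.End ℚ (Lam n) :=
  ∑ i : Fin n, (LinearMap.mulLeft ℚ (ExteriorAlgebra.ι ℚ (e n j i))) ∘ₗ
    (CliffordAlgebra.contractLeft (LinearMap.proj (k, i)) : Module.End ℚ (Lam n))

lemma ι_mul_ι_anticomm {n : ℕ} (u v : V n) :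
    (ExteriorAlgebra.ι ℚ u : Lam n) * ExteriorAlgebra.ι ℚ v =
      -(ExteriorAlgebra.ι ℚ v * ExteriorAlgebra.ι ℚ u) :=
  eq_neg_of_add_eq_zero_left (ExteriorAlgebra.ι_add_mul_swap u v)

lemma ι_mul_ι_mul_swap {n : ℕ} (u v : V n) (x : Lam n) :
    ExteriorAlgebra.ι ℚ u * (ExteriorAlgebra.ι ℚ v * x) =
      -(ExteriorAlgebra.ι ℚ v * (ExteriorAlgebra.ι ℚ u * x)) := by
  rw [← mul_assoc, ι_mul_ι_anticomm, neg_mul, mul_assoc]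

lemma ι_mul_ι_mul_self {n : ℕ} (u : V n) (x : Lam n) :
    ExteriorAlgebra.ι ℚ u * (ExteriorAlgebra.ι ℚ u * x) = 0 := by
  rw [← mul_assoc, ExteriorAlgebra.ι_sq_zero, zero_mul]

lemma polarization_ι_mul {n : ℕ} (j k l : Fin 3) (a : Fin n) (x : Lam n) :
    polarization n j k (ExteriorAlgebra.ι ℚ (e n l a) * x) =
      (if l = k then ExteriorAlgebra.ι ℚ (e n j a) * x else 0) +
        ExteriorAlgebra.ι ℚ (e n l a) * polarization n j k x := by
  have contract (i : Fin n) :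
      (CliffordAlgebra.contractLeft (LinearMap.proj (k, i)) : Module.End ℚ (Lam n))
        (ExteriorAlgebra.ι ℚ (e n l a) * x) =
      e n l a (k, i) • x - ExteriorAlgebra.ι ℚ (e n l a) *
        (CliffordAlgebra.contractLeft (LinearMap.proj (k, i)) : Module.End ℚ (Lam n)) x :=
    CliffordAlgebra.contractLeft_ι_mul _ _ _
  simp only [polarization, LinearMap.sum_apply, LinearMap.comp_apply, LinearMap.mulLeft_apply,
    contract, mul_sub, Finset.sum_sub_distrib, Finset.mul_sum, ← mul_assoc]
  rw [sub_eq_add_neg, ← Finset.sum_neg_distrib]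
  congr 1
  · by_cases h : l = k
    · simp [e, h, Pi.single_apply]
    · simp [e, h, Ne.symm h]
  · refine Finset.sum_congr rfl fun i _ => ?_
    rw [ι_mul_ι_anticomm (e n j i), neg_mul, neg_neg]

lemma polarization_one {n : ℕ} (j k : Fin 3) : polarization n j k 1 = 0 := by
  simp only [polarization, LinearMap.sum_apply, LinearMap.comp_apply]
  exact Finset.sum_eq_zero fun i _ => by
    rw [CliffordAlgebra.contractLeft_one, map_zero]

lemma polarization_prod_θ {n : ℕ} (j : Fin 3) {k : Fin 3} (hk : 0 ≠ k) (l : List (Fin n)) :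
    polarization n j k (l.map (θ n)).prod = 0 := by
  induction l with
  | nil => exact polarization_one j k
  | cons a l ih =>
    rw [List.map_cons, List.prod_cons, θ, polarization_ι_mul, if_neg hk, ih]
    simp

lemma Eθξ_eq_polarization (n : ℕ) : Eθξ n = polarization n 0 1 := rfl

lemma Eξρ_eq_polarization (n : ℕ) : Eξρ n = polarization n 1 2 := rfl

/-- The seed `θ_a ξ_b ρ_b + θ_b ξ_a ρ_b + θ_b ξ_b ρ_a`, multiplied by a monomial in the `θ`s. -/
def thetaSeed (n : ℕ) (a b : Fin n) (l : List (Fin n)) : Lam n :=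
  (θ n a * ξ n b * ρ n b + θ n b * ξ n a * ρ n b + θ n b * ξ n b * ρ n a) * (l.map (θ n)).prod

lemma Eθξ_thetaSeed {n : ℕ} (a b : Fin n) (l : List (Fin n)) :
    Eθξ n (thetaSeed n a b l) = 0 := by
  have hl := polarization_prod_θ (n := n) 0 (k := 1) (by decide) l
  simp only [Eθξ_eq_polarization, thetaSeed, add_mul, mul_assoc, map_add]
  generalize (l.map (θ n)).prod = x at hl
  simp only [θ, ξ, ρ, polarization_ι_mul, hl]
  simp [ι_mul_ι_mul_self, ι_mul_ι_mul_swap (e n 0 b) (e n 0 a)]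

lemma Eξρ_thetaSeed {n : ℕ} (a b : Fin n) (l : List (Fin n)) :
    Eξρ n (thetaSeed n a b l) = 0 := by
  have hl := polarization_prod_θ (n := n) 1 (k := 2) (by decide) l
  simp only [Eξρ_eq_polarization, thetaSeed, add_mul, mul_assoc, map_add]
  generalize (l.map (θ n)).prod = x at hl
  simp only [θ, ξ, ρ, polarization_ι_mul, hl]
  simp [ι_mul_ι_mul_self, ι_mul_ι_mul_swap (e n 1 b) (e n 1 a)]

lemma prod_θ_mul_mem_lamGrade {n : ℕ} (l : List (Fin n)) (b c : Fin n) :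
    (l.map (θ n)).prod * (ξ n b * ρ n c) ∈ lamGrade n l.length 1 1 := by
  set v : Fin l.length → V n := fun i => e n 0 (l.get i) with hv
  have hprod : (l.map (θ n)).prod = ExteriorAlgebra.ιMulti ℚ l.length v := by
    rw [ExteriorAlgebra.ιMulti_apply]
    conv_lhs => rw [← List.ofFn_get l, List.map_ofFn]
    rfl
  rw [hprod]
  by_cases hinj : Function.Injective l.get
  · have hsort : StrictMono (l.get ∘ Tuple.sort l.get) :=
      (Tuple.monotone_sort l.get).strictMono_of_injective
        (hinj.comp (Tuple.sort l.get).injective)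
    have hperm : ExteriorAlgebra.ιMulti ℚ l.length v =
        Equiv.Perm.sign (Tuple.sort l.get) •
          ExteriorAlgebra.ιMulti ℚ l.length (v ∘ Tuple.sort l.get) := by
      rw [AlternatingMap.map_perm, smul_smul, Int.units_mul_self, one_smul]
    have hmem : ExteriorAlgebra.ιMulti ℚ l.length (v ∘ Tuple.sort l.get) * (ξ n b * ρ n c) ∈
        lamGrade n l.length 1 1 := by
      refine Submodule.subset_span ⟨l.get ∘ Tuple.sort l.get, fun _ => b, fun _ => c, hsort,
        Subsingleton.strictMono _, Subsingleton.strictMono _, ?_⟩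
      rw [ExteriorAlgebra.ιMulti_apply, mul_assoc]
      simp [θ, hv]
    rw [hperm]
    rcases Int.units_eq_one_or (Equiv.Perm.sign (Tuple.sort l.get)) with h | h <;> rw [h]
    · simpa using hmem
    · simpa using hmem
  · rw [AlternatingMap.map_eq_zero_of_not_injective, zero_mul]
    · exact Submodule.zero_mem _
    · exact fun h => hinj fun i j hij => h (by simp only [hv, hij])

lemma θ_mul_ξ_mul_ρ_mul_prod_θ {n : ℕ} (a b c : Fin n) (l : List (Fin n)) :
    θ n a * ξ n b * ρ n c * (l.map (θ n)).prod =
      ((a :: l).map (θ n)).prod * (ξ n b * ρ n c) := by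
  have hcomm : Commute (ξ n b * ρ n c) (l.map (θ n)).prod := by
    refine Commute.list_prod_right _ _ fun x hx => ?_
    obtain ⟨i, -, rfl⟩ := List.mem_map.1 hx
    simp only [Commute, SemiconjBy, θ, ξ, ρ]
    rw [mul_assoc, ι_mul_ι_anticomm (e n 2 c), mul_neg, ← mul_assoc, ι_mul_ι_anticomm (e n 1 b),
      neg_mul, neg_neg, mul_assoc]
  rw [List.map_cons, List.prod_cons, mul_assoc (θ n a), mul_assoc (θ n a), mul_assoc (θ n a),
    hcomm.eq]

lemma thetaSeed_mem_lamGrade {n : ℕ} (a b : Fin n) (l : List (Fin n)) :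
    thetaSeed n a b l ∈ lamGrade n (l.length + 1) 1 1 := by
  simp only [thetaSeed, add_mul, θ_mul_ξ_mul_ρ_mul_prod_θ]
  exact add_mem (add_mem (prod_θ_mul_mem_lamGrade (a :: l) b b)
    (prod_θ_mul_mem_lamGrade (b :: l) a b)) (prod_θ_mul_mem_lamGrade (b :: l) b a)

lemma A_ι_e {n : ℕ} (σ : Equiv.Perm (Fin n)) (j : Fin 3) (i : Fin n) :
    A n σ (ExteriorAlgebra.ι ℚ (e n j i)) = ExteriorAlgebra.ι ℚ (e n j (σ i)) := by
  rw [A, ExteriorAlgebra.map_apply_ι]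
  congr 1
  ext ⟨k, m⟩
  simp [e, LinearMap.funLeft_apply, Pi.single_apply, Equiv.symm_apply_eq]

lemma A_thetaSeed {n : ℕ} (σ : Equiv.Perm (Fin n)) (a b : Fin n) (l : List (Fin n)) :
    A n σ (thetaSeed n a b l) = thetaSeed n (σ a) (σ b) (l.map σ) := by
  simp only [thetaSeed, map_mul, map_add, map_list_prod, List.map_map, θ, ξ, ρ, A_ι_e]
  congr 3
  funext i
  exact A_ι_e σ 0 i

lemma Δ₂_eq_sum_thetaSeed (n : ℕ) (hn : 3 ≤ n) :
    ∃ (a b : Fin n) (l : List (Fin n)), l.length = n - 3 ∧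
      Δ₂ n hn = ∑ σ : Equiv.Perm (Fin n), ((Equiv.Perm.sign σ : ℤ) : ℚ) •
        thetaSeed n (σ a) (σ b) (l.map σ) := by
  refine ⟨⟨0, by omega⟩, ⟨1, by omega⟩,
    List.ofFn fun i : Fin (n - 3) => ⟨(i : ℕ) + 2, by have := i.isLt; omega⟩,
    List.length_ofFn, ?_⟩
  refine Finset.sum_congr rfl fun σ _ => ?_
  rw [← A_thetaSeed, thetaSeed, List.map_ofFn]
  rfl

/-- The secondary theta-seed `Δ₂` is a weight vector of weight `(n-2,1,1)` annihilated by
both raising operators `E^{θ←ξ}` and `E^{ξ←ρ}`. -/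
theorem secondary_theta_seed_highest_weight (n : ℕ) (hn : 3 ≤ n) :
    Δ₂ n hn ∈ lamGrade n (n - 2) 1 1 ∧ Eθξ n (Δ₂ n hn) = 0 ∧ Eξρ n (Δ₂ n hn) = 0 := by
  obtain ⟨a, b, l, hl, hΔ⟩ := Δ₂_eq_sum_thetaSeed n hn
  rw [hΔ]
  refine ⟨Submodule.sum_mem _ fun σ _ => Submodule.smul_mem _ _ ?_, ?_, ?_⟩
  · have hlen : (l.map σ).length + 1 = n - 2 := by
      rw [List.length_map, hl]
      omega
    exact hlen ▸ thetaSeed_mem_lamGrade (σ a) (σ b) (l.map σ)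
  · simp only [map_sum, map_smul, Eθξ_thetaSeed, smul_zero, Finset.sum_const_zero]
  · simp only [map_sum, map_smul, Eξρ_thetaSeed, smul_zero, Finset.sum_const_zero]
end
end

section
/- For every n ≥ 1: 2 · Σ_{k,ℓ,d ≥ 0} C(n−1−d, ℓ) · C(n−1−k, d) · C(n−1−ℓ, k) = F_{3n}, i.e., the sum over all triples of nonnegative integers (k, ℓ, d) of the triple products of binomial coefficients equals half the Fibonacci number F_{3n}. (Equivalently, Σ_{k,ℓ,d ≥ 0} C(n−1−d,ℓ) C(n−1−k,d) C(n−1−ℓ,k) = (1/2)·F_{3n}.) -/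
open Finset

open Polynomial in
/-- The sum of the coefficients of `X ^ (i + s)` in `(X + 2) ^ i * (2 * X + 3) ^ j` over
`i + j = m`. For `s = 0` this is the trace of the `m`-th symmetric power of the cube of the
Fibonacci matrix. -/
noncomputable def shiftedTrace (s m : ℕ) : ℕ :=
  ∑ p ∈ antidiagonal m,
    ((X + 2 : ℕ[X]) ^ p.1 * (2 * X + 3 : ℕ[X]) ^ p.2).coeff (p.1 + s)

section

open Polynomial

theorem coeff_succ_X_add_two_mul (f : ℕ[X]) (r : ℕ) :
    ((X + 2) * f).coeff (r + 1) = f.coeff r + 2 * f.coeff (r + 1) := by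
  rw [add_mul, coeff_add, coeff_X_mul, coeff_ofNat_mul]

theorem coeff_succ_two_mul_X_add_three_mul (f : ℕ[X]) (r : ℕ) :
    ((2 * X + 3) * f).coeff (r + 1) = 2 * f.coeff r + 3 * f.coeff (r + 1) := by
  rw [add_mul, coeff_add, mul_assoc, coeff_ofNat_mul, coeff_X_mul, coeff_ofNat_mul]

theorem shiftedTrace_zero_succ (m : ℕ) :
    shiftedTrace 0 (m + 1) = 3 ^ (m + 1) + shiftedTrace 0 m + 2 * shiftedTrace 1 m := by
  have h : ((2 * X + 3 : ℕ[X]) ^ (m + 1)).coeff 0 = 3 ^ (m + 1) := by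
    simp [coeff_zero_eq_eval_zero]
  simp only [shiftedTrace, Nat.sum_antidiagonal_succ, add_zero, pow_zero, one_mul, h]
  rw [add_assoc, mul_sum, ← sum_add_distrib]
  congr 1
  refine sum_congr rfl fun p _ => ?_
  rw [pow_succ', mul_assoc, coeff_succ_X_add_two_mul]

theorem shiftedTrace_one_succ (m : ℕ) :
    shiftedTrace 1 (m + 1) = 2 * shiftedTrace 0 m + 3 * shiftedTrace 1 m := by
  have h : ((X + 2 : ℕ[X]) ^ (m + 1)).coeff (m + 1 + 1) = 0 := by
    refine coeff_eq_zero_of_natDegree_lt ?_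
    have h1 : (X + 2 : ℕ[X]).natDegree = 1 := natDegree_X_add_C 2
    have h2 := natDegree_pow_le (p := (X + 2 : ℕ[X])) (n := m + 1)
    rw [h1] at h2
    omega
  simp only [shiftedTrace, Nat.sum_antidiagonal_succ', add_zero, pow_zero, mul_one, h]
  rw [zero_add, mul_sum, mul_sum, ← sum_add_distrib]
  refine sum_congr rfl fun p _ => ?_
  rw [pow_succ', mul_left_comm, coeff_succ_two_mul_X_add_three_mul]

theorem fib_add_six (k : ℕ) : Nat.fib (k + 6) = 4 * Nat.fib (k + 3) + Nat.fib k := by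
  have h (i : ℕ) : Nat.fib (k + i + 2) = Nat.fib (k + i) + Nat.fib (k + i + 1) := Nat.fib_add_two
  have h0 := h 0
  have h1 := h 1
  have h2 := h 2
  have h3 := h 3
  have h4 := h 4
  simp only [add_assoc, Nat.reduceAdd, add_zero] at h0 h1 h2 h3 h4
  omega

theorem two_mul_shiftedTrace_eq_fib (m : ℕ) :
    2 * shiftedTrace 0 m = Nat.fib (3 * m + 3) ∧
      4 * shiftedTrace 1 m + 2 * 3 ^ (m + 1) + Nat.fib (3 * m + 3) = Nat.fib (3 * m + 6) := by
  induction m with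
  | zero =>
    have h0 : shiftedTrace 0 0 = 1 := by simp [shiftedTrace]
    have h1 : shiftedTrace 1 0 = 0 := by simp [shiftedTrace, coeff_one]
    rw [h0, h1]
    decide
  | succ m ih =>
    obtain ⟨h0, h1⟩ := ih
    have hf := fib_add_six (3 * m + 3)
    have hs := shiftedTrace_zero_succ m
    have ht := shiftedTrace_one_succ m
    have hp : 3 ^ (m + 1 + 1) = 3 * 3 ^ (m + 1) := pow_succ' 3 (m + 1)
    simp only [show 3 * (m + 1) + 3 = 3 * m + 6 by ring,
      show 3 * (m + 1) + 6 = 3 * m + 3 + 6 by ring]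
    simp only [show 3 * m + 3 + 3 = 3 * m + 6 by ring] at hf
    constructor <;> omega

theorem sum_choose_mul_pow_mul_pow {R : Type*} [CommSemiring R] (a b : R) {m d : ℕ}
    (hd : d ≤ m) :
    ∑ l ∈ range (m + 1), ((m - d).choose l : R) * (a ^ l * b ^ (m - l)) =
      b ^ d * (a + b) ^ (m - d) := by
  rw [add_pow, mul_sum]
  symm
  apply sum_subset_zero_on_sdiff (range_subset_range.2 (by omega))
  · intro l hl
    simp only [mem_sdiff, mem_range] at hl
    rw [Nat.choose_eq_zero_of_lt (by omega), Nat.cast_zero, zero_mul]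
  · intro l hl
    rw [mem_range] at hl
    rw [show m - l = d + (m - d - l) by omega, pow_add]
    ring

theorem sum_choose_mul_choose_mul_X_add_one_pow {m d : ℕ} (hd : d ≤ m) :
    ∑ l ∈ range (m + 1), ((m - d).choose l : ℕ[X]) *
        ∑ k ∈ range (m + 1), ((m - l).choose k : ℕ[X]) * (X + 1) ^ (m - k) =
      (X + 2) ^ d * (2 * X + 3) ^ (m - d) := by
  have h (l : ℕ) (hl : l ∈ range (m + 1)) :
      ∑ k ∈ range (m + 1), ((m - l).choose k : ℕ[X]) * (X + 1) ^ (m - k) =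
        (X + 1) ^ l * (X + 2) ^ (m - l) := by
    have := sum_choose_mul_pow_mul_pow (1 : ℕ[X]) (X + 1) (Nat.lt_succ_iff.1 (mem_range.1 hl))
    simp only [one_pow, one_mul] at this
    rw [this]
    ring
  rw [sum_congr rfl fun l hl => by rw [h l hl], sum_choose_mul_pow_mul_pow _ _ hd]
  ring

theorem sum_choose_mul_choose_mul_choose {m d : ℕ} (hd : d ≤ m) :
    ∑ l ∈ range (m + 1), (m - d).choose l *
        ∑ k ∈ range (m + 1), (m - l).choose k * (m - k).choose d =
      ((X + 2 : ℕ[X]) ^ d * (2 * X + 3 : ℕ[X]) ^ (m - d)).coeff d := by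
  rw [← sum_choose_mul_choose_mul_X_add_one_pow hd]
  simp only [finsetSum_coeff, coeff_natCast_mul, coeff_X_add_one_pow, Nat.cast_id]

end

/-- Twice the triple binomial sum
`Σ_{k,ℓ,d ≥ 0} C(n-1-d, ℓ) C(n-1-k, d) C(n-1-ℓ, k)` equals the Fibonacci number `F_{3n}`. -/
theorem two_mul_triple_binomial_sum_eq_fib (n : ℕ) (hn : 1 ≤ n) :
    2 * ∑ k ∈ Finset.range n, ∑ l ∈ Finset.range n, ∑ d ∈ Finset.range n,
        Nat.choose (n - 1 - d) l * Nat.choose (n - 1 - k) d * Nat.choose (n - 1 - l) k =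
      Nat.fib (3 * n) := by
  obtain ⟨m, rfl⟩ := Nat.exists_eq_add_of_le' hn
  rw [mul_add, mul_one, ← (two_mul_shiftedTrace_eq_fib m).1, shiftedTrace,
    Nat.sum_antidiagonal_eq_sum_range_succ_mk, Nat.add_sub_cancel]
  congr 1
  rw [sum_congr rfl fun k _ => sum_comm, sum_comm]
  refine sum_congr rfl fun d hd => ?_
  rw [add_zero, ← sum_choose_mul_choose_mul_choose (Nat.lt_succ_iff.1 (mem_range.1 hd)), sum_comm]
  refine sum_congr rfl fun l _ => ?_
  rw [mul_sum]
  exact sum_congr rfl fun k _ => by ring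
end

section
/- For every n ≥ 0: 2 · Σ_{k,ℓ,d ≥ 0} C(n−d, ℓ) · C(n−k, d) · C(n−ℓ, k) = F_{3(n+1)}, i.e., the index-shifted triple binomial sum equals half the Fibonacci number F_{3n+3}. -/
open Finset

section SymPow

open Polynomial

variable {R : Type*} [CommRing R]

/-- Evaluation at `(u, v)` of the homogenization in degree `n` commutes with multiplication by a
linear polynomial. -/
lemma sum_coeff_linear_mul {S : Type*} [CommRing S] [Algebra R S] (u v : S) (a b : R) (n : ℕ)
    {f : R[X]} (hf : f.natDegree ≤ n) :
    ∑ j ∈ range (n + 2), algebraMap R S (((C a + C b * X) * f).coeff j) * u ^ j * v ^ (n + 1 - j) =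
      (algebraMap R S a * v + algebraMap R S b * u) *
        ∑ j ∈ range (n + 1), algebraMap R S (f.coeff j) * u ^ j * v ^ (n - j) := by
  have hconst : ∑ j ∈ range (n + 2), algebraMap R S ((C a * f).coeff j) * u ^ j * v ^ (n + 1 - j) =
      algebraMap R S a * v * ∑ j ∈ range (n + 1), algebraMap R S (f.coeff j) * u ^ j * v ^ (n - j) := by
    rw [sum_range_succ, coeff_C_mul, coeff_eq_zero_of_natDegree_lt (by omega : f.natDegree < n + 1),
      mul_sum]
    simp only [mul_zero, map_zero, zero_mul, add_zero]
    refine sum_congr rfl fun j hj => ?_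
    rw [coeff_C_mul, map_mul, Nat.succ_sub (Nat.lt_succ_iff.mp (mem_range.mp hj)), pow_succ]
    ring
  have hlin : ∑ j ∈ range (n + 2),
        algebraMap R S ((C b * X * f).coeff j) * u ^ j * v ^ (n + 1 - j) =
      algebraMap R S b * u * ∑ j ∈ range (n + 1), algebraMap R S (f.coeff j) * u ^ j * v ^ (n - j) := by
    rw [sum_range_succ', mul_sum]
    simp only [mul_assoc, coeff_C_mul, coeff_X_mul, coeff_X_mul_zero, mul_zero, map_zero, zero_mul,
      add_zero, map_mul, Nat.add_sub_add_right]
    exact sum_congr rfl fun j _ => by ring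
  simp only [add_mul, coeff_add, map_add, sum_add_distrib, hconst, hlin]

lemma natDegree_linear_pow_mul_le (a b c d : R) (i k : ℕ) :
    ((C a + C b * X) ^ i * (C c + C d * X) ^ k).natDegree ≤ i + k := by
  have h (a b : R) (i : ℕ) : ((C a + C b * X) ^ i).natDegree ≤ i := by
    refine natDegree_pow_le_of_le i (m := 1) ?_ |>.trans (by simp)
    rw [add_comm]
    exact natDegree_linear_le
  exact natDegree_mul_le_of_le (h a b i) (h c d k)

/-- Evaluation at `(u, v)` of the homogenization of a product of linear polynomials. -/
lemma sum_coeff_linear_pow_mul {S : Type*} [CommRing S] [Algebra R S] (u v : S) (a b c d : R)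
    (i k : ℕ) :
    ∑ j ∈ range (i + k + 1),
        algebraMap R S (((C a + C b * X) ^ i * (C c + C d * X) ^ k).coeff j) * u ^ j *
          v ^ (i + k - j) =
      (algebraMap R S a * v + algebraMap R S b * u) ^ i *
        (algebraMap R S c * v + algebraMap R S d * u) ^ k := by
  induction i with
  | zero =>
    induction k with
    | zero => simp
    | succ k ih =>
      have h := sum_coeff_linear_mul u v c d (0 + k) (natDegree_linear_pow_mul_le a b c d 0 k)
      rw [ih] at h
      simp only [pow_zero, one_mul, zero_add, ← pow_succ'] at h ⊢
      exact h
  | succ i ih =>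
    have h := sum_coeff_linear_mul u v a b (i + k) (natDegree_linear_pow_mul_le a b c d i k)
    rw [ih] at h
    rw [show i + 1 + k = i + k + 1 by ring]
    simp only [pow_succ', mul_assoc] at h ⊢
    exact h

/-- The `n`-th symmetric power of a `2 × 2` matrix, in the basis of monomials. -/
noncomputable def symPow (n : ℕ) (A : Matrix (Fin 2) (Fin 2) R) :
    Matrix (Fin (n + 1)) (Fin (n + 1)) R :=
  Matrix.of fun i j =>
    ((C (A 1 0) + C (A 1 1) * X) ^ (i : ℕ) * (C (A 0 0) + C (A 0 1) * X) ^ (n - i)).coeff j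

lemma symPow_mul (n : ℕ) (A B : Matrix (Fin 2) (Fin 2) R) :
    symPow n (A * B) = symPow n A * symPow n B := by
  ext i m
  have h := sum_coeff_linear_pow_mul (C (B 1 0) + C (B 1 1) * X) (C (B 0 0) + C (B 0 1) * X)
    (A 1 0) (A 1 1) (A 0 0) (A 0 1) i (n - i)
  rw [Nat.add_sub_cancel' (Nat.lt_succ_iff.mp i.2)] at h
  simp only [symPow, Matrix.mul_apply, Matrix.of_apply, Fin.sum_univ_two]
  refine Eq.trans ?_ (Fin.sum_univ_eq_sum_range (fun j =>
    ((C (A 1 0) + C (A 1 1) * X) ^ (i : ℕ) * (C (A 0 0) + C (A 0 1) * X) ^ (n - i)).coeff j *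
    ((C (B 1 0) + C (B 1 1) * X) ^ j * (C (B 0 0) + C (B 0 1) * X) ^ (n - j)).coeff m) (n + 1)).symm
  simp only [← coeff_C_mul, ← finsetSum_coeff, ← mul_assoc]
  rw [algebraMap_eq] at h
  rw [h]
  simp only [map_add, map_mul]
  congr 2 <;> ring

lemma symPow_apply_fib_matrix (n : ℕ) (i j : Fin (n + 1)) :
    symPow n (!![1, 1; 1, 0] : Matrix (Fin 2) (Fin 2) R) i j = (n - i).choose j := by
  simp [symPow, coeff_one_add_X_pow]

lemma trace_symPow_lowerTriangular (n : ℕ) (a b c : R) :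
    (symPow n !![a, 0; b, c]).trace = ∑ i ∈ range (n + 1), c ^ i * a ^ (n - i) := by
  rw [Matrix.trace, ← Fin.sum_univ_eq_sum_range (fun i => c ^ i * a ^ (n - i))]
  refine sum_congr rfl fun i _ => ?_
  have h := coeff_pow_of_natDegree_le (p := C b + C c * X) (n := 1) (m := i)
    (by rw [add_comm]; exact natDegree_linear_le)
  simp only [mul_one] at h
  simp only [symPow, Matrix.diag_apply, Matrix.of_apply, Matrix.cons_val_zero, Matrix.cons_val_one,
    C_0, zero_mul, add_zero]
  rw [← C_pow, coeff_mul_C, h]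
  simp

lemma trace_symPow_conj (n : ℕ) (U T V : Matrix (Fin 2) (Fin 2) R) (h : V * U = 1) :
    (symPow n (U * T * V)).trace = (symPow n T).trace := by
  rw [symPow_mul, Matrix.trace_mul_comm, ← symPow_mul, ← mul_assoc, h, one_mul]

end SymPow

lemma trace_symPow_fib_matrix_cube (n : ℕ) :
    (symPow n (!![1, 1; 1, 0] * !![1, 1; 1, 0] * !![1, 1; 1, 0] : Matrix (Fin 2) (Fin 2) ℝ)).trace =
      ∑ i ∈ range (n + 1), (Real.goldenRatio ^ 3) ^ i * (Real.goldenConj ^ 3) ^ (n - i) := by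
  have hφ := Real.goldenRatio_sq
  have hψ : Real.goldenConj = 1 - Real.goldenRatio := by linarith [Real.goldenRatio_add_goldenConj]
  have hφ3 : Real.goldenRatio ^ 3 = 2 * Real.goldenRatio + 1 := by
    linear_combination (Real.goldenRatio + 1) * hφ
  have hψ3 : Real.goldenConj ^ 3 = 3 - 2 * Real.goldenRatio := by
    rw [hψ]; linear_combination (2 - Real.goldenRatio) * hφ
  have hconj : (!![1, 1; 1, 0] * !![1, 1; 1, 0] * !![1, 1; 1, 0] : Matrix (Fin 2) (Fin 2) ℝ) =
      !![1, Real.goldenRatio; 0, 1] * !![Real.goldenConj ^ 3, 0; 2, Real.goldenRatio ^ 3] *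
        !![1, -Real.goldenRatio; 0, 1] := by
    rw [hφ3, hψ3]
    generalize Real.goldenRatio = x at hφ
    ext i j
    fin_cases i <;> fin_cases j <;> simp <;> linarith
  rw [hconj, trace_symPow_conj _ _ _ _ (by simp [Matrix.one_fin_two]), trace_symPow_lowerTriangular]

lemma two_mul_sum_golden_cubes (n : ℕ) :
    2 * ∑ i ∈ range (n + 1), (Real.goldenRatio ^ 3) ^ i * (Real.goldenConj ^ 3) ^ (n - i) =
      Nat.fib (3 * (n + 1)) := by
  have h := (Commute.all (Real.goldenRatio ^ 3) (Real.goldenConj ^ 3)).geom_sum₂_mul (n + 1)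
  have hdiff : Real.goldenRatio ^ 3 - Real.goldenConj ^ 3 = 2 * √5 := by
    rw [← Real.goldenRatio_sub_goldenConj]
    linear_combination (Real.goldenRatio + 1) * Real.goldenRatio_sq -
      (Real.goldenConj + 1) * Real.goldenConj_sq
  rw [Real.coe_fib_eq, pow_mul, pow_mul, ← h, hdiff, eq_div_iff (by positivity)]
  simp only [Nat.add_sub_cancel]
  ring

/-- Twice the index-shifted triple binomial sum
`Σ_{k,ℓ,d ≥ 0} C(n-d, ℓ) C(n-k, d) C(n-ℓ, k)` equals the Fibonacci number `F_{3(n+1)}`. -/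
theorem two_mul_shifted_triple_binomial_sum_eq_fib (n : ℕ) :
    2 * ∑ k ∈ Finset.range (n + 1), ∑ l ∈ Finset.range (n + 1), ∑ d ∈ Finset.range (n + 1),
        Nat.choose (n - d) l * Nat.choose (n - k) d * Nat.choose (n - l) k =
      Nat.fib (3 * (n + 1)) := by
  rw [← Nat.cast_inj (R := ℝ), ← two_mul_sum_golden_cubes, ← trace_symPow_fib_matrix_cube,
    symPow_mul, symPow_mul]
  simp only [Matrix.trace, Matrix.diag_apply, Matrix.mul_apply, symPow_apply_fib_matrix, sum_mul,
    Finset.sum_range]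
  push_cast
  congr 1
  refine sum_congr rfl fun k _ => sum_congr rfl fun l _ => sum_congr rfl fun d _ => ?_
  ring
end

section
/- Define S(m) := Σ_{k,ℓ,d ≥ 0} C(m−d, ℓ) · C(m−k, d) · C(m−ℓ, k) for m ≥ 0. Then for every n ≥ 2, the recurrence S(n) = 4·S(n−1) + S(n−2) holds. -/
open Finset

/-- The triple binomial sum `S(m) = Σ_{k,ℓ,d ≥ 0} C(m-d, ℓ) C(m-k, d) C(m-ℓ, k)`. -/
def S (m : ℕ) : ℕ :=
  ∑ k ∈ Finset.range (m + 1), ∑ l ∈ Finset.range (m + 1), ∑ d ∈ Finset.range (m + 1),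
    Nat.choose (m - d) l * Nat.choose (m - k) d * Nat.choose (m - l) k

open Polynomial in
/-- The trace of the action of the substitution `x ↦ x + 2y`, `y ↦ 2x + 3y` on binary forms of
degree `m`, dehomogenized at `y = 1`. -/
noncomputable def symTrace (m : ℕ) : ℕ :=
  ∑ i ∈ range (m + 1), ((X + C 2) ^ i * (C 2 * X + C 3) ^ (m - i) : ℕ[X]).coeff i

open Polynomial in
/-- The sum of the entries next to the diagonal of the matrix whose trace is `symTrace m`. -/
noncomputable def symOffTrace (m : ℕ) : ℕ :=
  ∑ i ∈ range (m + 1), ((X + C 2) ^ i * (C 2 * X + C 3) ^ (m - i) : ℕ[X]).coeff (i + 1)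

/-- The binomial theorem, homogenized to degree `m`. -/
theorem sum_choose_sub_mul_pow {R : Type*} [CommSemiring R] (a b : R) {i m : ℕ} (h : i ≤ m) :
    ∑ l ∈ range (m + 1), ((m - i).choose l : R) * (a ^ l * b ^ (m - l)) =
      b ^ i * (a + b) ^ (m - i) := by
  rw [add_pow, mul_sum]
  symm
  apply sum_subset_zero_on_sdiff
  · exact range_mono (by omega)
  · intro l hl
    simp only [mem_sdiff, mem_range] at hl
    rw [Nat.choose_eq_zero_of_lt (by omega)]
    simp
  · intro l hl
    simp only [mem_range] at hl
    rw [show m - l = i + (m - i - l) by omega, pow_add]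
    ring

open Polynomial in
theorem S_eq_symTrace (m : ℕ) : S m = symTrace m := by
  unfold S symTrace
  refine sum_congr rfl fun k hk => ?_
  have hk' : k ≤ m := by simpa [Nat.lt_succ_iff] using hk
  have key : ((X + C 2) ^ k * (C 2 * X + C 3) ^ (m - k) : ℕ[X]) =
      ∑ d ∈ range (m + 1), ∑ l ∈ range (m + 1),
        (((m - d).choose l * (m - k).choose d : ℕ) : ℕ[X]) * (1 + X) ^ (m - l) := by
    have h := sum_choose_sub_mul_pow (1 + X : ℕ[X]) (X + C 2) hk'
    rw [show (1 + X + (X + C 2) : ℕ[X]) = C 2 * X + C 3 by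
      simp only [map_ofNat]; ring] at h
    rw [← h]
    refine sum_congr rfl fun d hd => ?_
    have hd' : d ≤ m := by simpa [Nat.lt_succ_iff] using hd
    have h' := sum_choose_sub_mul_pow (1 : ℕ[X]) (1 + X) hd'
    rw [show (1 + (1 + X) : ℕ[X]) = X + C 2 by simp only [map_ofNat]; ring] at h'
    rw [← h', mul_sum]
    refine sum_congr rfl fun l _ => ?_
    push_cast
    ring
  rw [key, sum_comm]
  simp only [finsetSum_coeff, coeff_natCast_mul, coeff_one_add_X_pow, Nat.cast_id]

open Polynomial in
theorem symTrace_succ (m : ℕ) :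
    symTrace (m + 1) = symTrace m + 2 * symOffTrace m + 3 ^ (m + 1) := by
  unfold symTrace symOffTrace
  rw [sum_range_succ', mul_sum, ← sum_add_distrib]
  congr 1
  · refine sum_congr rfl fun i _ => ?_
    rw [Nat.add_sub_add_right, pow_succ', mul_assoc, add_mul, coeff_add, coeff_X_mul, coeff_C_mul]
  · simp [coeff_zero_eq_eval_zero]

open Polynomial in
theorem symOffTrace_succ (m : ℕ) :
    symOffTrace (m + 1) = 2 * symTrace m + 3 * symOffTrace m := by
  unfold symTrace symOffTrace
  rw [sum_range_succ, mul_sum, mul_sum, ← sum_add_distrib]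
  have htop : ((X + C 2) ^ (m + 1) * (C 2 * X + C 3) ^ (m + 1 - (m + 1)) : ℕ[X]).coeff
      (m + 1 + 1) = 0 := by
    apply coeff_eq_zero_of_natDegree_lt
    simp only [Nat.sub_self, pow_zero, mul_one]
    refine natDegree_pow_le.trans_lt ?_
    rw [natDegree_X_add_C]
    omega
  rw [htop, add_zero]
  refine sum_congr rfl fun i hi => ?_
  have hi' : i ≤ m := by simpa [Nat.lt_succ_iff] using hi
  rw [Nat.succ_sub hi', pow_succ', mul_left_comm, add_mul, coeff_add, mul_assoc, coeff_C_mul,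
    coeff_X_mul, coeff_C_mul]

/-- The recurrence `S(n) = 4 S(n-1) + S(n-2)` for the triple binomial sum. -/
theorem triple_binomial_sum_recurrence (n : ℕ) (hn : 2 ≤ n) :
    S n = 4 * S (n - 1) + S (n - 2) := by
  obtain ⟨m, rfl⟩ := Nat.exists_eq_add_of_le' hn
  rw [show m + 2 - 1 = m + 1 by omega, Nat.add_sub_cancel]
  simp only [S_eq_symTrace]
  have h₂ : symTrace (m + 2) = _ := symTrace_succ (m + 1)
  have h₁ := symTrace_succ m
  have h₀ := symOffTrace_succ m
  rw [pow_succ] at h₂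
  omega
end
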